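/- arXiv:1403.5093 — 5 statements merged into one kernel-verified Lean document; each statement's English description precedes it below -/
import Mathlib

section
/- Let E be a complex Banach space and let T be a nonzero bounded linear operator on E that is quasinilpotent (i.e., its spectral radius is zero, equivalently ‖Tⁿ‖^{1/n} → 0). If the Deddens algebra D_T is closed in the operator norm topology and is a localizing subspace of B(E), then T has a nontrivial closed hyperinvariant subspace, i.e., a closed subspace F with F ≠ {0}, F ≠ E, which is invariant under every bounded operator commuting with T. -/
open Filter Metric

/-- `X` belongs to the Deddens algebra `D_T` associated with `T`: there is a constant
`M > 0` such that `‖Tⁿ X f‖ ≤ M ‖Tⁿ f‖` for all `n` and `f`. -/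
def InDeddens {E : Type*} [NormedAddCommGroup E] [NormedSpace ℂ E]
    (T X : E →L[ℂ] E) : Prop :=
  ∃ M > (0 : ℝ), ∀ (n : ℕ) (f : E), ‖(T ^ n) (X f)‖ ≤ M * ‖(T ^ n) f‖

/-- A set of operators `𝒳 ⊆ B(E)` is localizing: there is a closed ball `B` with `0 ∉ B`
such that every sequence in `B` has a subsequence `(f_{n_j})` for which there are operators
`X_j ∈ 𝒳` with `‖X_j‖ ≤ 1` and `X_j f_{n_j}` converging in norm to a nonzero vector. -/
def IsLocalizing {E : Type*} [NormedAddCommGroup E] [NormedSpace ℂ E]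
    (𝒳 : Set (E →L[ℂ] E)) : Prop :=
  ∃ (x₀ : E) (r : ℝ), 0 < r ∧ (0 : E) ∉ closedBall x₀ r ∧
    ∀ f : ℕ → E, (∀ n, f n ∈ closedBall x₀ r) →
      ∃ (φ : ℕ → ℕ) (X : ℕ → (E →L[ℂ] E)) (g : E),
        StrictMono φ ∧ (∀ j, X j ∈ 𝒳) ∧ (∀ j, ‖X j‖ ≤ 1) ∧ g ≠ 0 ∧
        Tendsto (fun j => X j (f (φ j))) atTop (nhds g)

lemma inDeddens_comm {E : Type*} [NormedAddCommGroup E] [NormedSpace ℂ E]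
    (T R : E →L[ℂ] E) (h : R ∘L T = T ∘L R) : InDeddens T R := by
  refine ⟨‖R‖ + 1, by positivity, fun n f => ?_⟩
  have hc : Commute R T := h
  have h1 : (T ^ n) (R f) = R ((T ^ n) f) := by
    have := (hc.pow_right n).eq
    exact (DFunLike.congr_fun this f).symm
  rw [h1]
  refine (R.le_opNorm _).trans ?_
  gcongr
  linarith

lemma inDeddens_mul {E : Type*} [NormedAddCommGroup E] [NormedSpace ℂ E]
    {T R X : E →L[ℂ] E} (hR : InDeddens T R) (hX : InDeddens T X) : InDeddens T (R ∘L X) := by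
  obtain ⟨M, hM, h1⟩ := hR
  obtain ⟨N, hN, h2⟩ := hX
  refine ⟨M * N, by positivity, fun n f => ?_⟩
  calc ‖(T ^ n) (R (X f))‖ ≤ M * ‖(T ^ n) (X f)‖ := h1 n (X f)
    _ ≤ M * (N * ‖(T ^ n) f‖) := by gcongr; exact h2 n f
    _ = _ := by ring

/-- The Deddens algebra as a submodule. -/
def deddensSub {E : Type*} [NormedAddCommGroup E] [NormedSpace ℂ E]
    (T : E →L[ℂ] E) : Submodule ℂ (E →L[ℂ] E) where
  carrier := {X | InDeddens T X}
  zero_mem' := ⟨1, one_pos, fun n f => by simp⟩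
  add_mem' := by
    rintro X Y ⟨M, hM, h1⟩ ⟨N, hN, h2⟩
    refine ⟨M + N, by positivity, fun n f => ?_⟩
    have : (T ^ n) ((X + Y) f) = (T ^ n) (X f) + (T ^ n) (Y f) := by
      rw [add_apply, map_add]
    rw [this]
    have := norm_add_le ((T ^ n) (X f)) ((T ^ n) (Y f))
    have := h1 n f
    have := h2 n f
    linarith
  smul_mem' := by
    rintro c X ⟨M, hM, h1⟩
    refine ⟨(‖c‖ + 1) * M, by positivity, fun n f => ?_⟩
    have : (T ^ n) ((c • X) f) = c • (T ^ n) (X f) := by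
      rw [smul_apply, map_smul]
    rw [this, norm_smul, mul_assoc]
    gcongr
    · linarith
    · exact h1 n f

lemma deddens_uniform {E : Type*} [NormedAddCommGroup E] [NormedSpace ℂ E] [CompleteSpace E]
    (T : E →L[ℂ] E) (hclosed : IsClosed {X : E →L[ℂ] E | InDeddens T X}) :
    ∃ C > (0 : ℝ), ∀ X, InDeddens T X → ∀ n f, ‖(T ^ n) (X f)‖ ≤ C * ‖X‖ * ‖(T ^ n) f‖ := by
  have hc : IsClosed (deddensSub T : Set (E →L[ℂ] E)) := hclosed
  have : CompleteSpace (deddensSub T) := hc.completeSpace_coe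
  let g : ℕ × E → (deddensSub T →L[ℂ] E) := fun p =>
    (((‖(T ^ p.1) p.2‖⁻¹ : ℝ) : ℂ)) •
      ((T ^ p.1) ∘L (ContinuousLinearMap.apply ℂ E p.2) ∘L (deddensSub T).subtypeL)
  have hg : ∀ p (X : deddensSub T), ‖g p X‖ = ‖(T ^ p.1) p.2‖⁻¹ * ‖(T ^ p.1) (X.1 p.2)‖ := by
    intro p X
    have : g p X = (((‖(T ^ p.1) p.2‖⁻¹ : ℝ) : ℂ)) • (T ^ p.1) (X.1 p.2) := rfl
    rw [this, norm_smul, Complex.norm_real, norm_inv, norm_norm]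
  have hpt : ∀ X : deddensSub T, ∃ C, ∀ p, ‖g p X‖ ≤ C := by
    rintro ⟨X, M, hM, hX⟩
    refine ⟨M, fun p => ?_⟩
    rw [hg]
    rcases (norm_nonneg ((T ^ p.1) p.2)).eq_or_lt with h0 | h0
    · rw [← h0]; simpa using hM.le
    · rw [inv_mul_le_iff₀ h0, mul_comm]
      exact hX p.1 p.2
  obtain ⟨C, hC⟩ := banach_steinhaus (E := deddensSub T) (F := E) (𝕜 := ℂ) (𝕜₂ := ℂ) (σ₁₂ := RingHom.id ℂ) (g := g) hpt
  refine ⟨|C| + 1, by positivity, fun X hX n f => ?_⟩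
  rcases (norm_nonneg ((T ^ n) f)).eq_or_lt with h0 | h0
  · obtain ⟨M, hM, h⟩ := hX
    have := h n f
    rw [← h0] at this ⊢
    simpa using this
  · have h1 := ContinuousLinearMap.le_opNorm (E := deddensSub T) (F := E) (𝕜 := ℂ) (𝕜₂ := ℂ)
      (σ₁₂ := RingHom.id ℂ) (g (n, f)) ⟨X, hX⟩
    rw [hg] at h1
    have h2 := hC (n, f)
    have h3 : ‖(⟨X, hX⟩ : deddensSub T)‖ = ‖X‖ := rfl
    rw [h3] at h1
    have h4 : ‖(T ^ n) f‖⁻¹ * ‖(T ^ n) (X f)‖ ≤ (|C| + 1) * ‖X‖ := by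
      refine h1.trans ?_
      gcongr
      linarith [le_abs_self C]
    rw [inv_mul_le_iff₀ h0] at h4
    linarith

lemma quasi_bound {E : Type*} [NormedAddCommGroup E] [NormedSpace ℂ E] [CompleteSpace E]
    (T : E →L[ℂ] E) (hquasi : spectralRadius ℂ T = 0) (ε : ℝ) (hε : 0 < ε) :
    ∀ᶠ n : ℕ in atTop, ‖T ^ n‖ ≤ ε ^ n := by
  have h := spectrum.pow_norm_pow_one_div_tendsto_nhds_spectralRadius T
  rw [hquasi] at h
  have h2 := h.eventually (gt_mem_nhds (ENNReal.ofReal_pos.2 hε))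
  filter_upwards [h2, eventually_gt_atTop 0] with n hn hn0
  have h3 := (ENNReal.ofReal_lt_ofReal_iff hε).1 hn
  have h4 : ‖T ^ n‖ = (‖T ^ n‖ ^ (1 / n : ℝ)) ^ n := by
    rw [← Real.rpow_natCast, ← Real.rpow_mul (norm_nonneg _), one_div_mul_cancel (by positivity),
      Real.rpow_one]
  rw [h4]
  gcongr

/-- Orbit of a vector under the commutant. -/
def commOrbit {E : Type*} [NormedAddCommGroup E] [NormedSpace ℂ E]
    (T : E →L[ℂ] E) (y : E) : Submodule ℂ E where
  carrier := {z | ∃ R : E →L[ℂ] E, R ∘L T = T ∘L R ∧ R y = z}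
  zero_mem' := ⟨0, by simp, by simp⟩
  add_mem' := by
    rintro _ _ ⟨R, hR, rfl⟩ ⟨S, hS, rfl⟩
    exact ⟨R + S, by rw [ContinuousLinearMap.add_comp, ContinuousLinearMap.comp_add, hR, hS], rfl⟩
  smul_mem' := by
    rintro c _ ⟨R, hR, rfl⟩
    exact ⟨c • R, by rw [ContinuousLinearMap.smul_comp, ContinuousLinearMap.comp_smul, hR], rfl⟩

theorem deddens_closed_localizing_implies_hyperinvariant
    {E : Type*} [NormedAddCommGroup E] [NormedSpace ℂ E] [CompleteSpace E]
    (T : E →L[ℂ] E) (hT : T ≠ 0)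
    (hquasi : spectralRadius ℂ T = 0)
    (hclosed : IsClosed {X : E →L[ℂ] E | InDeddens T X})
    (hloc : IsLocalizing {X : E →L[ℂ] E | InDeddens T X}) :
    ∃ F : Submodule ℂ E, IsClosed (F : Set E) ∧ F ≠ ⊥ ∧ F ≠ ⊤ ∧
      ∀ R : E →L[ℂ] E, R ∘L T = T ∘L R → ∀ x ∈ F, R x ∈ F := by
  by_contra hno
  have key : ∀ F : Submodule ℂ E, IsClosed (F : Set E) → F ≠ ⊥ →
      (∀ R : E →L[ℂ] E, R ∘L T = T ∘L R → ∀ x ∈ F, R x ∈ F) → F = ⊤ := by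
    intro F h1 h2 h3
    by_contra h4
    exact hno ⟨F, h1, h2, h4, h3⟩
  -- `T` is injective
  have hinj : ∀ y, T y = 0 → y = 0 := by
    intro y hy
    by_contra hy0
    have := key (LinearMap.ker (T : E →ₗ[ℂ] E)) T.isClosed_ker
      (fun h => hy0 (by
        have : y ∈ LinearMap.ker (T : E →ₗ[ℂ] E) := hy
        rw [h] at this
        simpa using this))
      (fun R hR x hx => by
        have hx' : T x = 0 := hx
        have h5 : R (T x) = T (R x) := DFunLike.congr_fun hR x
        change T (R x) = 0
        rw [← h5, hx', map_zero])
    apply hT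
    ext x
    have hx : x ∈ LinearMap.ker (T : E →ₗ[ℂ] E) := by rw [this]; trivial
    exact hx
  -- orbits are dense
  have hdense : ∀ y, y ≠ 0 → (commOrbit T y).topologicalClosure = ⊤ := by
    intro y hy
    apply key
    · exact Submodule.isClosed_topologicalClosure _
    · intro h
      apply hy
      have : y ∈ (commOrbit T y).topologicalClosure :=
        Submodule.le_topologicalClosure _ ⟨ContinuousLinearMap.id ℂ E, by simp, rfl⟩
      rw [h] at this
      simpa using this
    · intro R hR x hx
      have hx' : x ∈ closure (commOrbit T y : Set E) := hx
      change R x ∈ closure (commOrbit T y : Set E)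
      refine map_mem_closure R.continuous hx' ?_
      rintro _ ⟨S, hS, rfl⟩
      refine ⟨R ∘L S, ?_, rfl⟩
      rw [ContinuousLinearMap.comp_assoc, hS, ← ContinuousLinearMap.comp_assoc, hR,
        ContinuousLinearMap.comp_assoc]
  obtain ⟨x₀, r, hr, h0, hB⟩ := hloc
  -- uniform bound
  have hstep : ∃ c > (0 : ℝ), ∀ f ∈ closedBall x₀ r, ∃ X, InDeddens T X ∧ ‖X‖ ≤ c ∧
      T (X f) ∈ closedBall x₀ r := by
    by_contra hcon
    push Not at hcon
    choose f hf hfX using fun n : ℕ => hcon (n + 1 : ℝ) (by positivity)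
    obtain ⟨φ, X, g, hφ, hX, hX1, hg, hlim⟩ := hB f hf
    have hTg : T g ≠ 0 := fun h => hg (hinj g h)
    have hx₀ : x₀ ∈ closure (commOrbit T (T g) : Set E) := by
      have : x₀ ∈ (commOrbit T (T g)).topologicalClosure := by rw [hdense _ hTg]; trivial
      exact this
    obtain ⟨_, ⟨R, hR, rfl⟩, hRd⟩ := Metric.mem_closure_iff.1 hx₀ r hr
    have hlim2 : Tendsto (fun j => R (T (X j (f (φ j))))) atTop (nhds (R (T g))) :=
      ((R.continuous.comp T.continuous).tendsto g).comp hlim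
    have hev : ∀ᶠ j in atTop, R (T (X j (f (φ j)))) ∈ ball x₀ r :=
      hlim2.eventually (isOpen_ball.mem_nhds (by rw [mem_ball, dist_comm]; exact hRd))
    obtain ⟨N, hN⟩ := exists_nat_ge ‖R‖
    obtain ⟨j, hj, hjN⟩ := (hev.and (eventually_ge_atTop N)).exists
    have hD : InDeddens T (R ∘L X j) := inDeddens_mul (inDeddens_comm T R hR) (hX j)
    refine hfX (φ j) (R ∘L X j) hD ?_ ?_
    · have h1 : ‖R ∘L X j‖ ≤ ‖R‖ * ‖X j‖ := R.opNorm_comp_le _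
      have h2 : ‖R‖ * ‖X j‖ ≤ ‖R‖ * 1 := by gcongr; exact hX1 j
      have h3 : (N : ℝ) ≤ φ j := by exact_mod_cast hjN.trans (hφ.id_le j)
      linarith
    · have h5 : R (T (X j (f (φ j)))) = T (R (X j (f (φ j)))) := DFunLike.congr_fun hR _
      change T (R (X j (f (φ j)))) ∈ _
      rw [← h5]
      exact ball_subset_closedBall hj
  obtain ⟨c, hc, hstep⟩ := hstep
  obtain ⟨C, hC, hunif⟩ := deddens_uniform T hclosed
  have hiter : ∀ k : ℕ, ∃ f ∈ closedBall x₀ r, ∀ m : ℕ,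
      ‖(T ^ m) f‖ ≤ (C * c) ^ k * ‖(T ^ (m + k)) x₀‖ := by
    intro k
    induction k with
    | zero => exact ⟨x₀, mem_closedBall_self hr.le, fun m => by simp⟩
    | succ k ih =>
      obtain ⟨f, hf, hb⟩ := ih
      obtain ⟨X, hX, hXc, hXf⟩ := hstep f hf
      refine ⟨T (X f), hXf, fun m => ?_⟩
      have h1 : (T ^ m) (T (X f)) = (T ^ (m + 1)) (X f) := by rw [pow_succ]; rfl
      rw [h1]
      calc ‖(T ^ (m + 1)) (X f)‖ ≤ C * ‖X‖ * ‖(T ^ (m + 1)) f‖ := hunif X hX _ _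
        _ ≤ C * c * ((C * c) ^ k * ‖(T ^ (m + 1 + k)) x₀‖) := by
            gcongr
            exact hb _
        _ = _ := by rw [pow_succ, show m + 1 + k = m + (k + 1) by ring]; ring
  have hδ : 0 < ‖x₀‖ - r := by
    rw [mem_closedBall, dist_comm, dist_zero_right, not_le] at h0
    linarith
  have hK : 0 < C * c := by positivity
  have hq := quasi_bound T hquasi ((C * c)⁻¹ * (1 / 2)) (by positivity)
  have hsm : Tendsto (fun n : ℕ => (1 / 2 : ℝ) ^ n * ‖x₀‖) atTop (nhds 0) := by
    simpa using (tendsto_pow_atTop_nhds_zero_of_lt_one (r := (1 / 2 : ℝ))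
      (by norm_num) (by norm_num)).mul_const ‖x₀‖
  obtain ⟨n, hn1, hn2⟩ := (hq.and (hsm.eventually (gt_mem_nhds hδ))).exists
  obtain ⟨f, hf, hb⟩ := hiter n
  have h1 := hb 0
  have h2 : ‖x₀‖ - r ≤ ‖f‖ := by
    rw [mem_closedBall, dist_comm, dist_eq_norm] at hf
    have := norm_sub_norm_le x₀ f
    linarith
  have h3 : ‖f‖ ≤ (C * c) ^ n * ‖(T ^ n) x₀‖ := by simpa using h1
  have h4 : (C * c) ^ n * ‖(T ^ n) x₀‖ ≤ (1 / 2 : ℝ) ^ n * ‖x₀‖ := by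
    calc (C * c) ^ n * ‖(T ^ n) x₀‖
        ≤ (C * c) ^ n * ((((C * c)⁻¹ * (1 / 2)) ^ n) * ‖x₀‖) := by
          gcongr
          exact ((T ^ n).le_opNorm x₀).trans (by gcongr)
      _ = ((C * c) * ((C * c)⁻¹ * (1 / 2))) ^ n * ‖x₀‖ := by rw [mul_pow (C * c)]; ring
      _ = _ := by rw [mul_inv_cancel_left₀ hK.ne']
  linarith
end

section
/- Let E be a complex Banach space and T ∈ B(E). The Deddens algebra D_T is closed in the operator norm topology if and only if there is a constant M > 0 such that for every X ∈ D_T, for all n ∈ ℕ, and for all f ∈ E, one has ‖TⁿXf‖ ≤ M‖X‖·‖Tⁿf‖. -/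
/-- Banach-Steinhaus in pointwise form. -/
theorem bs_aux {V E ι : Type*} [NormedAddCommGroup V] [NormedSpace ℂ V] [CompleteSpace V]
    [NormedAddCommGroup E] [NormedSpace ℂ E] (g : ι → V →L[ℂ] E)
    (h : ∀ x, ∃ C, ∀ i, ‖g i x‖ ≤ C) : ∃ C, ∀ i x, ‖g i x‖ ≤ C * ‖x‖ := by
  obtain ⟨C, hC⟩ := banach_steinhaus h
  exact ⟨C, fun i x => (g i).le_of_opNorm_le (hC i) x⟩

/-- The Deddens algebra as a submodule. -/
def deddensSubmodule {E : Type*} [NormedAddCommGroup E] [NormedSpace ℂ E]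
    (T : E →L[ℂ] E) : Submodule ℂ (E →L[ℂ] E) where
  carrier := {X | InDeddens T X}
  zero_mem' := ⟨1, one_pos, fun n f => by simp⟩
  add_mem' := by
    rintro X Y ⟨M, hM, hX⟩ ⟨N, hN, hY⟩
    refine ⟨M + N, by positivity, fun n f => ?_⟩
    have h1 := hX n f
    have h2 := hY n f
    have h3 := norm_add_le ((T ^ n) (X f)) ((T ^ n) (Y f))
    rw [ContinuousLinearMap.add_apply, map_add]
    linarith
  smul_mem' := by
    rintro c X ⟨M, hM, hX⟩
    refine ⟨(‖c‖ + 1) * M, by positivity, fun n f => ?_⟩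
    have h1 := hX n f
    rw [ContinuousLinearMap.smul_apply, map_smul, norm_smul, mul_assoc]
    gcongr
    linarith

/-- The Deddens algebra `D_T` is closed in the operator norm topology if and only if there
is a constant `M > 0` such that `‖Tⁿ X f‖ ≤ M ‖X‖ ‖Tⁿ f‖` for all `X ∈ D_T`, `n` and `f`. -/
theorem deddens_closed_iff_uniform_bound
    {E : Type*} [NormedAddCommGroup E] [NormedSpace ℂ E] [CompleteSpace E]
    (T : E →L[ℂ] E) :
    IsClosed {X : E →L[ℂ] E | InDeddens T X} ↔
      ∃ M > (0 : ℝ), ∀ X : E →L[ℂ] E, InDeddens T X →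
        ∀ (n : ℕ) (f : E), ‖(T ^ n) (X f)‖ ≤ M * ‖X‖ * ‖(T ^ n) f‖ := by
  constructor
  · intro hcl
    have hcl' : IsClosed ((deddensSubmodule T : Submodule ℂ (E →L[ℂ] E)) : Set (E →L[ℂ] E)) := hcl
    haveI : CompleteSpace (deddensSubmodule T) := hcl'.completeSpace_coe
    let g : ℕ × E → (deddensSubmodule T →L[ℂ] E) := fun i =>
      (((‖(T ^ i.1) i.2‖⁻¹ : ℝ) : ℂ)) •
        ((T ^ i.1).comp ((ContinuousLinearMap.apply ℂ E i.2).comp (deddensSubmodule T).subtypeL))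
    have hg : ∀ i X, ‖g i X‖ = ‖(T ^ i.1) i.2‖⁻¹ * ‖(T ^ i.1) ((X : E →L[ℂ] E) i.2)‖ := by
      intro i X
      simp [g, norm_smul]
    have hb : ∀ X : deddensSubmodule T, ∃ C, ∀ i, ‖g i X‖ ≤ C := by
      rintro ⟨X, M, hM, hX⟩
      refine ⟨M, fun i => ?_⟩
      rw [hg]
      rcases (norm_nonneg ((T ^ i.1) i.2)).eq_or_lt with h | h
      · rw [← h]; simp [hM.le]
      · rw [inv_mul_le_iff₀ h, mul_comm]
        exact hX i.1 i.2
    obtain ⟨C, hC⟩ := bs_aux (V := deddensSubmodule T) g hb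
    refine ⟨|C| + 1, by positivity, fun X hX n f => ?_⟩
    rcases (norm_nonneg ((T ^ n) f)).eq_or_lt with h | h
    · obtain ⟨M, hM, hX⟩ := hX
      have := hX n f
      rw [← h] at this ⊢
      simpa using this
    · have h1 := hC (n, f) ⟨X, hX⟩
      rw [hg, inv_mul_le_iff₀ h, mul_comm] at h1
      refine h1.trans ?_
      have h2 : C ≤ |C| + 1 := by linarith [le_abs_self C]
      change C * ‖X‖ * _ ≤ _
      gcongr
  · rintro ⟨M, hM, h⟩
    have hc : IsClosed {X : E →L[ℂ] E | ∀ (n : ℕ) (f : E),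
        ‖(T ^ n) (X f)‖ ≤ M * ‖X‖ * ‖(T ^ n) f‖} := by
      simp only [Set.setOf_forall]
      refine isClosed_iInter fun n => isClosed_iInter fun f => isClosed_le ?_ ?_
      · fun_prop
      · fun_prop
    refine isClosed_of_closure_subset fun X hX => ?_
    have hX' := closure_minimal (fun X hX => h X hX) hc hX
    refine ⟨M * ‖X‖ + 1, by positivity, fun n f => (hX' n f).trans ?_⟩
    gcongr
    linarith
end

section
/- Let E be a complex Banach space, let T ∈ B(E) be a nonzero operator whose commutant {T}′ is a transitive algebra, let 𝓡 ⊆ B(E) be a localizing algebra with {T}′ ⊆ 𝓡, and let B ⊆ E be a closed ball not containing 0 that witnesses that 𝓡 is localizing. Then there is a constant c > 0 such that for every f ∈ B there exists X ∈ 𝓡 with ‖X‖ ≤ c and TXf ∈ B. -/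
open Filter Metric

/-- Let `T` be a nonzero operator whose commutant is a transitive algebra, let `𝓡` be a
localizing algebra containing the commutant of `T`, with witnessing closed ball
`B = closedBall x₀ r` (with `0 ∉ B`). Then there is a constant `c > 0` such that for every
`f ∈ B` there is an `X ∈ 𝓡` with `‖X‖ ≤ c` and `T X f ∈ B`. -/
theorem key_lemma_localizing_ball
    {E : Type*} [NormedAddCommGroup E] [NormedSpace ℂ E] [CompleteSpace E]
    (T : E →L[ℂ] E) (hT : T ≠ 0)
    (htrans : ∀ F : Submodule ℂ E, IsClosed (F : Set E) →
      (∀ R : E →L[ℂ] E, R ∘L T = T ∘L R → ∀ x ∈ F, R x ∈ F) → F = ⊥ ∨ F = ⊤)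
    (𝓡 : Subalgebra ℂ (E →L[ℂ] E))
    (hcomm : ∀ R : E →L[ℂ] E, R ∘L T = T ∘L R → R ∈ 𝓡)
    (x₀ : E) (r : ℝ) (hr : 0 < r) (h0 : (0 : E) ∉ closedBall x₀ r)
    (hloc : ∀ f : ℕ → E, (∀ n, f n ∈ closedBall x₀ r) →
      ∃ (φ : ℕ → ℕ) (X : ℕ → (E →L[ℂ] E)) (g : E),
        StrictMono φ ∧ (∀ j, X j ∈ 𝓡) ∧ (∀ j, ‖X j‖ ≤ 1) ∧ g ≠ 0 ∧
        Tendsto (fun j => X j (f (φ j))) atTop (nhds g)) :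
    ∃ c > (0 : ℝ), ∀ f ∈ closedBall x₀ r,
      ∃ X ∈ 𝓡, ‖X‖ ≤ c ∧ T (X f) ∈ closedBall x₀ r := by
  by_contra! hcon
  -- `T` is injective, since its kernel is invariant under the commutant
  have hker : LinearMap.ker (T : E →ₗ[ℂ] E) = ⊥ := by
    rcases htrans (LinearMap.ker (T : E →ₗ[ℂ] E)) T.isClosed_ker (by
      intro R hR x hx
      have h1 : R (T x) = T (R x) := congrArg (fun S : E →L[ℂ] E => S x) hR
      have hx' : T x = 0 := hx
      change T (R x) = 0
      rw [← h1, hx', map_zero]) with h | h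
    · exact h
    · exfalso
      apply hT
      ext x
      have hx : x ∈ LinearMap.ker (T : E →ₗ[ℂ] E) := by rw [h]; trivial
      exact hx
  -- orbits of nonzero vectors under the commutant are dense
  have hdense : ∀ y : E, y ≠ 0 → ∃ R : E →L[ℂ] E, R ∘L T = T ∘L R ∧ R y ∈ ball x₀ r := by
    intro y hy
    let M : Submodule ℂ E :=
      { carrier := {z | ∃ R : E →L[ℂ] E, R ∘L T = T ∘L R ∧ R y = z}
        zero_mem' := ⟨0, by simp, by simp⟩
        add_mem' := by
          rintro a b ⟨R, hR, rfl⟩ ⟨S, hS, rfl⟩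
          exact ⟨R + S, by rw [ContinuousLinearMap.add_comp, ContinuousLinearMap.comp_add, hR, hS],
            rfl⟩
        smul_mem' := by
          rintro a b ⟨R, hR, rfl⟩
          exact ⟨a • R, by rw [ContinuousLinearMap.smul_comp, ContinuousLinearMap.comp_smul, hR],
            rfl⟩ }
    have hyM : y ∈ M := ⟨ContinuousLinearMap.id ℂ E, by ext; simp, rfl⟩
    have hinv : ∀ R : E →L[ℂ] E, R ∘L T = T ∘L R →
        ∀ x ∈ M.topologicalClosure, R x ∈ M.topologicalClosure := by
      intro R hR x hx
      refine map_mem_closure R.continuous hx ?_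
      rintro _ ⟨S, hS, rfl⟩
      refine ⟨R ∘L S, ?_, rfl⟩
      rw [ContinuousLinearMap.comp_assoc, hS, ← ContinuousLinearMap.comp_assoc, hR,
        ContinuousLinearMap.comp_assoc]
    rcases htrans _ M.isClosed_topologicalClosure hinv with h | h
    · have := M.le_topologicalClosure hyM
      rw [h] at this
      exact absurd this hy
    · have hx : x₀ ∈ M.topologicalClosure := by rw [h]; trivial
      obtain ⟨z, ⟨R, hR, rfl⟩, hz⟩ := Metric.mem_closure_iff.1 hx r hr
      exact ⟨R, hR, by rwa [mem_ball, dist_comm]⟩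
  have hc : ∀ n : ℕ, ∃ f ∈ closedBall x₀ r, ∀ X ∈ 𝓡, ‖X‖ ≤ (n : ℝ) + 1 →
      T (X f) ∉ closedBall x₀ r := fun n => hcon _ (by positivity)
  choose f hf hfX using hc
  obtain ⟨φ, X, g, hφ, hX, hX1, hg, hlim⟩ := hloc f hf
  have hTg : T g ≠ 0 := fun h => hg ((LinearMap.ker_eq_bot'.1 hker) g h)
  obtain ⟨R, hR, hRg⟩ := hdense _ hTg
  have hlim2 : Tendsto (fun j => R (T (X j (f (φ j))))) atTop (nhds (R (T g))) :=
    ((R.continuous.comp T.continuous).tendsto g).comp hlim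
  have hev := hlim2.eventually (isOpen_ball.mem_nhds hRg)
  obtain ⟨N, hN⟩ := exists_nat_ge ‖R‖
  obtain ⟨j, hj, hjN⟩ := (hev.and (eventually_ge_atTop N)).exists
  refine hfX (φ j) (R ∘L X j) (𝓡.mul_mem (hcomm R hR) (hX j)) ?_ ?_
  · have h1 : ‖R ∘L X j‖ ≤ ‖R‖ * ‖X j‖ := ContinuousLinearMap.opNorm_comp_le _ _
    have h2 : ‖R‖ * ‖X j‖ ≤ ‖R‖ := mul_le_of_le_one_right (norm_nonneg _) (hX1 j)
    have h3 : (N : ℝ) ≤ φ j := by exact_mod_cast hjN.trans (hφ.id_le j)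
    linarith
  · have h1 : R (T (X j (f (φ j)))) = T (R (X j (f (φ j)))) :=
      congrArg (fun S : E →L[ℂ] E => S (X j (f (φ j)))) hR
    change T (R (X j (f (φ j)))) ∈ closedBall x₀ r
    rw [← h1]
    exact ball_subset_closedBall hj
end

section
/- Let E be a complex Banach space and let T ∈ B(E) be a nonzero operator. Suppose λ ∈ ℂ is an extended eigenvalue of T with |λ| ≠ 1 such that the subspace E_T(λ) of all extended eigenoperators of T corresponding to λ is localizing. Then T has a nontrivial closed hyperinvariant subspace. -/
open Filter Metric

/-- Without hyperinvariant subspaces, the commutant orbit of a nonzero vector is dense. -/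
lemma exists_commutant_mem_ball {E : Type*} [NormedAddCommGroup E] [NormedSpace ℂ E]
    (T : E →L[ℂ] E)
    (hno : ∀ F : Submodule ℂ E, IsClosed (F : Set E) →
      (∀ R : E →L[ℂ] E, R ∘L T = T ∘L R → ∀ x ∈ F, R x ∈ F) → F = ⊥ ∨ F = ⊤)
    (g : E) (hg : g ≠ 0) (x₀ : E) (r : ℝ) (hr : 0 < r) :
    ∃ R : E →L[ℂ] E, R ∘L T = T ∘L R ∧ R g ∈ ball x₀ r := by
  let S : Submodule ℂ E :=
    { carrier := {x | ∃ R : E →L[ℂ] E, R ∘L T = T ∘L R ∧ R g = x}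
      add_mem' := by
        rintro _ _ ⟨R, hR, rfl⟩ ⟨Q, hQ, rfl⟩
        exact ⟨R + Q, by rw [ContinuousLinearMap.add_comp, ContinuousLinearMap.comp_add, hR, hQ],
          rfl⟩
      zero_mem' := ⟨0, by simp, rfl⟩
      smul_mem' := by
        rintro a _ ⟨R, hR, rfl⟩
        exact ⟨a • R, by rw [ContinuousLinearMap.smul_comp, ContinuousLinearMap.comp_smul, hR],
          rfl⟩ }
  have hgS : g ∈ S := ⟨ContinuousLinearMap.id ℂ E, by ext; simp, rfl⟩
  have hinv : ∀ R : E →L[ℂ] E, R ∘L T = T ∘L R →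
      ∀ x ∈ S.topologicalClosure, R x ∈ S.topologicalClosure := by
    intro R hR x hx
    refine map_mem_closure (s := (S : Set E)) (t := (S : Set E)) R.continuous hx ?_
    rintro _ ⟨Q, hQ, rfl⟩
    refine ⟨R ∘L Q, ?_, rfl⟩
    rw [ContinuousLinearMap.comp_assoc, hQ, ← ContinuousLinearMap.comp_assoc, hR,
      ContinuousLinearMap.comp_assoc]
  rcases hno S.topologicalClosure S.isClosed_topologicalClosure hinv with h | h
  · exact absurd ((Submodule.eq_bot_iff _).1 h g (S.le_topologicalClosure hgS)) hg
  · have hx : x₀ ∈ closure (S : Set E) := by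
      have : x₀ ∈ S.topologicalClosure := h ▸ Submodule.mem_top
      exact this
    obtain ⟨y, ⟨R, hR, rfl⟩, hy⟩ := Metric.mem_closure_iff.1 hx r hr
    exact ⟨R, hR, by rwa [mem_ball, dist_comm]⟩

lemma tendsto_pow_sum_mul_pow (q d : ℝ) (hq0 : 0 ≤ q) (hq : q < 1) :
    Tendsto (fun n : ℕ => q ^ (∑ i ∈ Finset.range n, i) * d ^ n) atTop (nhds 0) := by
  apply Summable.tendsto_atTop_zero
  refine summable_of_ratio_norm_eventually_le (r := 1 / 2) (by norm_num) ?_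
  have h : Tendsto (fun n : ℕ => q ^ n * |d|) atTop (nhds 0) := by
    simpa using (tendsto_pow_atTop_nhds_zero_of_lt_one hq0 hq).mul_const |d|
  filter_upwards [h.eventually (gt_mem_nhds (show (0 : ℝ) < 1 / 2 by norm_num))] with n hn
  have e : q ^ (∑ i ∈ Finset.range (n + 1), i) * d ^ (n + 1)
      = (q ^ n * d) * (q ^ (∑ i ∈ Finset.range n, i) * d ^ n) := by
    rw [Finset.sum_range_succ]; ring
  rw [e, norm_mul]
  refine mul_le_mul_of_nonneg_right ?_ (norm_nonneg _)
  rw [Real.norm_eq_abs, abs_mul, abs_of_nonneg (pow_nonneg hq0 n)]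
  exact hn.le

lemma ext_pow_apply {E : Type*} [NormedAddCommGroup E] [NormedSpace ℂ E]
    (T Y : E →L[ℂ] E) (l : ℂ) (h : ∀ x, T (Y x) = l • Y (T x)) (n : ℕ) (x : E) :
    (T ^ n) (Y x) = l ^ n • Y ((T ^ n) x) := by
  induction n generalizing x with
  | zero => simp
  | succ n ih =>
    rw [pow_succ, ContinuousLinearMap.mul_apply, h, map_smul, ih, smul_smul,
      ContinuousLinearMap.mul_apply, pow_succ, mul_comm]

/-- If `T` is a nonzero operator, `l` is an extended eigenvalue of `T` with `|l| ≠ 1`, and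
the subspace `E_T(l) = {X | T X = l X T}` of extended eigenoperators is localizing, then
`T` has a nontrivial closed hyperinvariant subspace. -/
theorem extended_eigenvalue_localizing_hyperinvariant
    {E : Type*} [NormedAddCommGroup E] [NormedSpace ℂ E] [CompleteSpace E]
    (T : E →L[ℂ] E) (hT : T ≠ 0) (l : ℂ)
    (hev : ∃ X : E →L[ℂ] E, X ≠ 0 ∧ T ∘L X = l • (X ∘L T))
    (hl : ‖l‖ ≠ 1)
    (hloc : IsLocalizing {X : E →L[ℂ] E | T ∘L X = l • (X ∘L T)}) :
    ∃ F : Submodule ℂ E, IsClosed (F : Set E) ∧ F ≠ ⊥ ∧ F ≠ ⊤ ∧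
      ∀ R : E →L[ℂ] E, R ∘L T = T ∘L R → ∀ x ∈ F, R x ∈ F := by
  by_contra hcon
  have hno : ∀ F : Submodule ℂ E, IsClosed (F : Set E) →
      (∀ R : E →L[ℂ] E, R ∘L T = T ∘L R → ∀ x ∈ F, R x ∈ F) → F = ⊥ ∨ F = ⊤ := by
    intro F hF hR
    by_contra hc
    rw [not_or] at hc
    exact hcon ⟨F, hF, hc.1, hc.2, hR⟩
  -- `T` is injective
  have hinj : ∀ x, T x = 0 → x = 0 := by
    rcases hno (LinearMap.ker (T : E →ₗ[ℂ] E)) T.isClosed_ker (by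
      intro R hR x hx
      have hx' : T x = 0 := hx
      have := congrArg (fun A : E →L[ℂ] E => A x) hR
      simp only [ContinuousLinearMap.comp_apply, hx', map_zero] at this
      exact this.symm) with h | h
    · intro x hx
      exact (Submodule.eq_bot_iff _).1 h x hx
    · exfalso
      apply hT
      ext x
      have : x ∈ LinearMap.ker (T : E →ₗ[ℂ] E) := h ▸ Submodule.mem_top
      exact this
  obtain ⟨x₀, r, hr, h0, hB⟩ := hloc
  -- uniform step
  have key : ∃ N : ℕ, ∀ f ∈ closedBall x₀ r, ∃ Y : E →L[ℂ] E,
      (∀ x, T (Y x) = l • Y (T x)) ∧ ‖Y‖ ≤ N ∧ T (Y f) ∈ closedBall x₀ r := by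
    by_contra hk
    push Not at hk
    choose f hf hfY using hk
    obtain ⟨φ, X, g, hφ, hX, hX1, hg, hlim⟩ := hB f hf
    obtain ⟨R, hR, hRg⟩ := exists_commutant_mem_ball T hno (T g)
      (fun h => hg (hinj g h)) x₀ r hr
    have hRT : ∀ x, R (T x) = T (R x) := fun x => congrArg (fun A : E →L[ℂ] E => A x) hR
    have hlim2 : Tendsto (fun j => R (T (X j (f (φ j))))) atTop (nhds (R (T g))) :=
      ((R.continuous.comp T.continuous).tendsto g).comp hlim
    have ev1 := hlim2.eventually (isOpen_ball.mem_nhds hRg)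
    obtain ⟨M, hM⟩ := exists_nat_ge ‖R‖
    obtain ⟨j, hj1, hj2⟩ := (ev1.and (eventually_ge_atTop M)).exists
    refine hfY (φ j) (R ∘L X j) ?_ ?_ ?_
    · intro x
      have := congrArg (fun A : E →L[ℂ] E => A x) (hX j)
      simp only [ContinuousLinearMap.comp_apply, ContinuousLinearMap.smul_apply] at this ⊢
      rw [← hRT, this, map_smul]
    · calc ‖R ∘L X j‖ ≤ ‖R‖ * ‖X j‖ := ContinuousLinearMap.opNorm_comp_le _ _
        _ ≤ ‖R‖ * 1 := mul_le_mul_of_nonneg_left (hX1 j) (norm_nonneg _)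
        _ ≤ M := by simpa using hM
        _ ≤ (φ j : ℝ) := by exact_mod_cast hj2.trans (hφ.id_le j)
    · rw [ContinuousLinearMap.comp_apply, ← hRT]
      exact ball_subset_closedBall hj1
  obtain ⟨N, hN⟩ := key
  -- it suffices to find small elements of the ball
  have fin : ∀ q d C : ℝ, 0 ≤ q → q < 1 → (∀ n : ℕ, ∃ f ∈ closedBall x₀ r,
      ‖f‖ ≤ q ^ (∑ i ∈ Finset.range n, i) * d ^ n * C) → False := by
    intro q d C hq0 hq h
    choose f hf hfn using h
    have ht : Tendsto f atTop (nhds 0) := by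
      refine squeeze_zero_norm hfn ?_
      simpa using (tendsto_pow_sum_mul_pow q d hq0 hq).mul_const C
    exact h0 (isClosed_closedBall.mem_of_tendsto ht (Eventually.of_forall hf))
  have hTpow : ∀ (n : ℕ) (x : E), ‖(T ^ n) x‖ ≤ ‖T‖ ^ n * ‖x‖ := by
    intro n
    induction n with
    | zero => intro x; simp
    | succ n ih =>
      intro x
      rw [pow_succ, ContinuousLinearMap.mul_apply]
      calc _ ≤ ‖T‖ ^ n * ‖T x‖ := ih _
        _ ≤ ‖T‖ ^ n * (‖T‖ * ‖x‖) := by gcongr; exact T.le_opNorm x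
        _ = _ := by ring
  have hx₀ : x₀ ∈ closedBall x₀ r := mem_closedBall_self hr.le
  rcases lt_or_gt_of_ne hl with hl1 | hl1
  · -- `|l| < 1`
    have ind : ∀ n : ℕ, ∃ W : E →L[ℂ] E, (∀ x, T (W x) = l ^ n • W (T x)) ∧
        (∀ x, ‖W x‖ ≤ (N : ℝ) ^ n * ‖x‖) ∧
        l ^ (∑ i ∈ Finset.range (n + 1), i) • W ((T ^ n) x₀) ∈ closedBall x₀ r := by
      intro n
      induction n with
      | zero => exact ⟨ContinuousLinearMap.id ℂ E, by simp, by simp, by simpa using hr.le⟩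
      | succ n ih =>
        obtain ⟨W, hW, hWn, hWB⟩ := ih
        obtain ⟨Y, hY, hYn, hYB⟩ := hN _ hWB
        refine ⟨Y ∘L W, ?_, ?_, ?_⟩
        · intro x
          simp only [ContinuousLinearMap.comp_apply]
          rw [hY, hW, map_smul, smul_smul, pow_succ, mul_comm]
        · intro x
          calc ‖Y (W x)‖ ≤ ‖Y‖ * ‖W x‖ := Y.le_opNorm _
            _ ≤ N * ((N : ℝ) ^ n * ‖x‖) := by gcongr; exact hWn x
            _ = _ := by ring
        · rw [map_smul, map_smul, hY, hW, map_smul, smul_smul, smul_smul] at hYB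
          rw [Finset.sum_range_succ, pow_add, pow_succ' T, pow_succ l n, ContinuousLinearMap.mul_apply,
            ContinuousLinearMap.comp_apply]
          convert hYB using 2
          ring
    refine fin ‖l‖ (N * ‖T‖) ‖x₀‖ (norm_nonneg _) hl1 (fun n => ?_)
    obtain ⟨W, -, hWn, hWB⟩ := ind n
    refine ⟨_, hWB, ?_⟩
    rw [norm_smul, norm_pow]
    have h1 : ‖l‖ ^ (∑ i ∈ Finset.range (n + 1), i) ≤ ‖l‖ ^ (∑ i ∈ Finset.range n, i) :=
      pow_le_pow_of_le_one (norm_nonneg _) hl1.le (by rw [Finset.sum_range_succ]; omega)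
    calc _ ≤ ‖l‖ ^ (∑ i ∈ Finset.range n, i) * ((N : ℝ) ^ n * (‖T‖ ^ n * ‖x₀‖)) := by
          gcongr
          exact (hWn _).trans (by gcongr; exact hTpow n x₀)
      _ = _ := by rw [mul_pow]; ring
  · -- `|l| > 1`
    have hl0 : l ≠ 0 := by
      rintro rfl
      simp at hl1
      linarith
    have ind : ∀ n : ℕ, ∃ h : E, ‖h‖ ≤ (N : ℝ) ^ n * ‖x₀‖ ∧
        l⁻¹ ^ (∑ i ∈ Finset.range n, i) • (T ^ n) h ∈ closedBall x₀ r := by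
      intro n
      induction n with
      | zero => exact ⟨x₀, by simp, by simpa using hr.le⟩
      | succ n ih =>
        obtain ⟨h, hh, hB'⟩ := ih
        obtain ⟨Y, hY, hYn, hYB⟩ := hN _ hB'
        refine ⟨Y h, ?_, ?_⟩
        · calc ‖Y h‖ ≤ ‖Y‖ * ‖h‖ := Y.le_opNorm _
            _ ≤ N * ((N : ℝ) ^ n * ‖x₀‖) := by gcongr
            _ = _ := by ring
        · rw [map_smul, map_smul] at hYB
          rw [Finset.sum_range_succ, pow_add, pow_succ' T, ContinuousLinearMap.mul_apply,
            ext_pow_apply T Y l hY, map_smul, smul_smul, mul_assoc, ← mul_pow,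
            inv_mul_cancel₀ hl0, one_pow, mul_one]
          exact hYB
    refine fin ‖l⁻¹‖ (N * ‖T‖) ‖x₀‖ (norm_nonneg _) ?_ (fun n => ?_)
    · rw [norm_inv]
      exact inv_lt_one_of_one_lt₀ hl1
    obtain ⟨h, hh, hB'⟩ := ind n
    refine ⟨_, hB', ?_⟩
    rw [norm_smul, norm_pow]
    calc _ ≤ ‖l⁻¹‖ ^ (∑ i ∈ Finset.range n, i) * (‖T‖ ^ n * ((N : ℝ) ^ n * ‖x₀‖)) := by
          gcongr
          exact (hTpow n h).trans (by gcongr)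
      _ = _ := by rw [mul_pow]; ring
end

section
/- Let E be a complex Banach space and let T ∈ B(E) be a nonzero quasinilpotent operator. Suppose λ ∈ ℂ is an extended eigenvalue of T with |λ| = 1 such that the subspace E_T(λ) of all extended eigenoperators of T corresponding to λ is localizing. Then T has a nontrivial closed hyperinvariant subspace. -/
open Filter Metric

theorem aux_pow_small {E : Type*} [NormedAddCommGroup E] [NormedSpace ℂ E] [CompleteSpace E]
    (T : E →L[ℂ] E) (hquasi : spectralRadius ℂ T = 0) (c : ℝ) (hc : 0 < c) :
    ∀ᶠ n : ℕ in atTop, c ^ n * ‖T ^ n‖ ≤ (1 / 2 : ℝ) ^ n := by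
  have h := spectrum.pow_norm_pow_one_div_tendsto_nhds_spectralRadius T
  rw [hquasi] at h
  have hpos : (0 : ENNReal) < ENNReal.ofReal (1 / (2 * c)) := by
    rw [ENNReal.ofReal_pos]; positivity
  filter_upwards [h.eventually (gt_mem_nhds hpos), eventually_ge_atTop 1] with n hn hn1
  have h2 : ‖T ^ n‖ ^ (1 / n : ℝ) < 1 / (2 * c) :=
    (ENNReal.ofReal_lt_ofReal_iff (by positivity)).1 hn
  have h3 : (‖T ^ n‖ ^ (1 / n : ℝ)) ^ n ≤ (1 / (2 * c)) ^ n := by gcongr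
  have h4 : (‖T ^ n‖ ^ (1 / n : ℝ)) ^ n = ‖T ^ n‖ := by
    rw [one_div]
    exact Real.rpow_inv_natCast_pow (norm_nonneg _) (by omega)
  rw [h4] at h3
  calc c ^ n * ‖T ^ n‖ ≤ c ^ n * (1 / (2 * c)) ^ n := by gcongr
    _ = (1 / 2 : ℝ) ^ n := by
      rw [← mul_pow]; congr 1; field_simp

/-- The closure of the orbit of `g` under the commutant of `T`. -/
def orbitSub {E : Type*} [NormedAddCommGroup E] [NormedSpace ℂ E]
    (T : E →L[ℂ] E) (g : E) : Submodule ℂ E where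
  carrier := {y | ∃ R : E →L[ℂ] E, R ∘L T = T ∘L R ∧ R g = y}
  zero_mem' := ⟨0, by simp, by simp⟩
  add_mem' := by
    rintro a b ⟨R, hR, rfl⟩ ⟨S, hS, rfl⟩
    exact ⟨R + S, by rw [ContinuousLinearMap.add_comp, ContinuousLinearMap.comp_add, hR, hS],
      by simp⟩
  smul_mem' := by
    rintro c a ⟨R, hR, rfl⟩
    exact ⟨c • R, by rw [ContinuousLinearMap.smul_comp, ContinuousLinearMap.comp_smul, hR],
      by simp⟩

/-- If `T` is a nonzero quasinilpotent operator, `l` is an extended eigenvalue of `T` with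
`|l| = 1`, and the subspace `E_T(l) = {X | T X = l X T}` of extended eigenoperators is
localizing, then `T` has a nontrivial closed hyperinvariant subspace. -/
theorem extended_eigenvalue_unit_modulus_quasinilpotent_hyperinvariant
    {E : Type*} [NormedAddCommGroup E] [NormedSpace ℂ E] [CompleteSpace E]
    (T : E →L[ℂ] E) (hT : T ≠ 0)
    (hquasi : spectralRadius ℂ T = 0) (l : ℂ)
    (hev : ∃ X : E →L[ℂ] E, X ≠ 0 ∧ T ∘L X = l • (X ∘L T))
    (hl : ‖l‖ = 1)
    (hloc : IsLocalizing {X : E →L[ℂ] E | T ∘L X = l • (X ∘L T)}) :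
    ∃ F : Submodule ℂ E, IsClosed (F : Set E) ∧ F ≠ ⊥ ∧ F ≠ ⊤ ∧
      ∀ R : E →L[ℂ] E, R ∘L T = T ∘L R → ∀ x ∈ F, R x ∈ F := by
  by_contra hno
  have hno' : ∀ F : Submodule ℂ E, IsClosed (F : Set E) →
      (∀ R : E →L[ℂ] E, R ∘L T = T ∘L R → ∀ x ∈ F, R x ∈ F) → F ≠ ⊥ → F = ⊤ := by
    intro F h1 h2 h3
    by_contra h4
    exact hno ⟨F, h1, h3, h4, h2⟩
  have hinj : ∀ g : E, g ≠ 0 → T g ≠ 0 := by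
    intro g hg hTg
    have := hno' (LinearMap.ker (T : E →ₗ[ℂ] E)) T.isClosed_ker (by
      intro R hR x hx
      have hx' : T x = 0 := hx
      have := congrArg (fun S : E →L[ℂ] E => S x) hR
      simp only [ContinuousLinearMap.comp_apply, hx', map_zero] at this
      exact this.symm) (by
      intro hb
      have : g ∈ LinearMap.ker (T : E →ₗ[ℂ] E) := hTg
      rw [hb] at this
      exact hg this)
    apply hT
    ext x
    have hx : x ∈ LinearMap.ker (T : E →ₗ[ℂ] E) := by rw [this]; trivial
    exact hx
  have hdense : ∀ g : E, g ≠ 0 → ∀ (x : E) (r : ℝ), 0 < r →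
      ∃ R : E →L[ℂ] E, R ∘L T = T ∘L R ∧ R g ∈ ball x r := by
    intro g hg x r hr
    have h := hno' (orbitSub T g).topologicalClosure (Submodule.isClosed_topologicalClosure _) (by
      intro R hR y hy
      have hmaps : Set.MapsTo R (orbitSub T g : Set E) (orbitSub T g : Set E) := by
        rintro _ ⟨S, hS, rfl⟩
        refine ⟨R ∘L S, ?_, rfl⟩
        rw [ContinuousLinearMap.comp_assoc, hS, ← ContinuousLinearMap.comp_assoc, hR,
          ContinuousLinearMap.comp_assoc]
      exact hmaps.closure R.continuous hy) (by
      intro hb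
      have : g ∈ (orbitSub T g).topologicalClosure :=
        Submodule.le_topologicalClosure _ ⟨ContinuousLinearMap.id ℂ E, rfl, rfl⟩
      rw [hb] at this
      exact hg this)
    have hx : x ∈ closure (orbitSub T g : Set E) := by
      rw [← Submodule.topologicalClosure_coe, h]; trivial
    obtain ⟨_, ⟨R, hR, rfl⟩, hd⟩ := Metric.mem_closure_iff.1 hx r hr
    exact ⟨R, hR, by rwa [mem_ball, dist_comm]⟩
  obtain ⟨x₀, r, hr, h0, hloc⟩ := hloc
  -- uniform step
  have hstep : ∃ n : ℕ, ∀ f ∈ closedBall x₀ r, ∃ X R : E →L[ℂ] E,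
      T ∘L X = l • (X ∘L T) ∧ ‖X‖ ≤ 1 ∧ R ∘L T = T ∘L R ∧ ‖R‖ ≤ n ∧
      R (T (X f)) ∈ closedBall x₀ r := by
    by_contra hcon
    push Not at hcon
    choose f hf hbad using hcon
    obtain ⟨φ, X, g, hφ, hX, hX1, hg, hlim⟩ := hloc f hf
    obtain ⟨R, hR, hRg⟩ := hdense (T g) (hinj g hg) x₀ r hr
    have hlim2 : Tendsto (fun j => R (T (X j (f (φ j))))) atTop (nhds (R (T g))) :=
      ((R.continuous.comp T.continuous).tendsto g).comp hlim
    have e1 := hlim2.eventually (isOpen_ball.mem_nhds hRg)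
    have e2 : ∀ᶠ j in atTop, ‖R‖ ≤ (φ j : ℝ) :=
      (tendsto_natCast_atTop_atTop.comp hφ.tendsto_atTop).eventually_ge_atTop _
    obtain ⟨j, h1, h2⟩ := (e1.and e2).exists
    exact hbad (φ j) (X j) R (hX j) (hX1 j) hR h2 (ball_subset_closedBall h1)
  obtain ⟨N, hN⟩ := hstep
  set c : ℝ := N + 1 with hcdef
  have hc : 0 < c := by positivity
  have hind : ∀ n : ℕ, ∃ (A : E →L[ℂ] E) (μ : ℂ), ‖μ‖ = 1 ∧ (∀ x, T (A x) = μ • A (T x)) ∧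
      ‖A‖ ≤ c ^ n ∧ A ((T ^ n) x₀) ∈ closedBall x₀ r := by
    intro n
    induction n with
    | zero =>
      refine ⟨ContinuousLinearMap.id ℂ E, 1, by simp, by simp, ?_, ?_⟩
      · simpa using ContinuousLinearMap.norm_id_le
      · simpa using hr.le
    | succ n ih =>
      obtain ⟨A, μ, hμ, hA, hAn, hmem⟩ := ih
      obtain ⟨X, R, hX, hX1, hR, hRN, hm⟩ := hN _ hmem
      have hX' : ∀ x, T (X x) = l • X (T x) := fun x =>
        congrArg (fun S : E →L[ℂ] E => S x) hX
      have hR' : ∀ x, R (T x) = T (R x) := fun x =>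
        congrArg (fun S : E →L[ℂ] E => S x) hR
      refine ⟨(l * μ) • (R ∘L (X ∘L A)), l * μ, by simp [hl, hμ], ?_, ?_, ?_⟩
      · intro x
        simp [← hR', hX', hA, smul_smul]
      · rw [norm_smul, norm_mul, hl, hμ, one_mul, one_mul]
        calc ‖R ∘L (X ∘L A)‖ ≤ ‖R‖ * (‖X‖ * ‖A‖) :=
              (ContinuousLinearMap.opNorm_comp_le _ _).trans
                (mul_le_mul_of_nonneg_left (ContinuousLinearMap.opNorm_comp_le _ _)
                  (norm_nonneg _))
          _ ≤ c * (1 * c ^ n) := by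
              gcongr
              linarith
          _ = c ^ (n + 1) := by ring
      · convert hm using 1
        simp [hX', hA, smul_smul, pow_succ']
  have hd : 0 < ‖x₀‖ - r := by
    rw [mem_closedBall, dist_zero_left] at h0
    linarith
  have hlow : ∀ᶠ n : ℕ in atTop, ‖x₀‖ - r ≤ (1 / 2 : ℝ) ^ n * ‖x₀‖ := by
    filter_upwards [aux_pow_small T hquasi c hc] with n hn
    obtain ⟨A, μ, hμ, hA, hAn, hmem⟩ := hind n
    have h1 : ‖x₀‖ - r ≤ ‖A ((T ^ n) x₀)‖ := by
      rw [mem_closedBall, dist_eq_norm, norm_sub_rev] at hmem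
      have := norm_sub_norm_le x₀ (A ((T ^ n) x₀))
      linarith
    calc ‖x₀‖ - r ≤ ‖A ((T ^ n) x₀)‖ := h1
      _ ≤ ‖A‖ * (‖T ^ n‖ * ‖x₀‖) := A.le_opNorm_of_le ((T ^ n).le_opNorm x₀)
      _ ≤ c ^ n * (‖T ^ n‖ * ‖x₀‖) := by gcongr
      _ = (c ^ n * ‖T ^ n‖) * ‖x₀‖ := by ring
      _ ≤ (1 / 2 : ℝ) ^ n * ‖x₀‖ := by gcongr
  have hlim : Tendsto (fun n : ℕ => (1 / 2 : ℝ) ^ n * ‖x₀‖) atTop (nhds (0 * ‖x₀‖)) :=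
    (tendsto_pow_atTop_nhds_zero_of_lt_one (by norm_num) (by norm_num)).mul_const _
  have := ge_of_tendsto hlim hlow
  linarith
end
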